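/- arXiv:1410.3451 — 2 statements merged into one kernel-verified Lean document; each statement's English description precedes it below -/
import Mathlib

section
/- Let X be a scheme and W, W′ ⊂ X closed subschemes with the same underlying topological space |W| = |W′|. Then W is affine if and only if W′ is affine. -/
open AlgebraicGeometry

namespace AlgebraicGeometry.Scheme

open CategoryTheory TopologicalSpace

universe u

/-- Restriction of sections of the structure sheaf, as a ring homomorphism. -/
noncomputable def res {X : Scheme.{u}} {U V : X.Opens} (h : U ≤ V) : Γ(X, V) →+* Γ(X, U) :=
  (X.presheaf.map (homOfLE h).op).hom

variable {X Y W : Scheme.{u}}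

@[simp]
lemma res_res {U V T : X.Opens} (h₁ : U ≤ V) (h₂ : V ≤ T) (s : Γ(X, T)) :
    res h₁ (res h₂ s) = res (h₁.trans h₂) s := by
  simp only [res, ← CommRingCat.comp_apply, ← Functor.map_comp]
  rfl

lemma app_res (f : X ⟶ Y) {U V : Y.Opens} (h : U ≤ V) (s : Γ(Y, V)) :
    f.app U (res h s) = res (f.preimage_mono h) (f.app V s) := by
  exact congr($(f.naturality (homOfLE h).op) s)

lemma basicOpen_res_hom {U V : X.Opens} (h : U ≤ V) (s : Γ(X, V)) :
    X.basicOpen (res h s) = U ⊓ X.basicOpen s :=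
  X.basicOpen_res s (homOfLE h).op

lemma eq_of_res_eq {ι : Type*} {V : ι → X.Opens} {U : X.Opens} (hV : ∀ i, V i ≤ U)
    (hU : U ≤ ⨆ i, V i) {s t : Γ(X, U)} (h : ∀ i, res (hV i) s = res (hV i) t) : s = t := by
  apply X.IsSheaf.section_ext
  intro x hx
  obtain ⟨i, hi⟩ := Opens.mem_iSup.mp (hU hx)
  exact ⟨V i, hV i, hi, h i⟩

lemma exists_res_eq {ι : Type u} {V : ι → X.Opens} (hV : ⨆ i, V i = ⊤)
    (s : ∀ i, Γ(X, V i))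
    (h : ∀ i j, res (inf_le_left : V i ⊓ V j ≤ V i) (s i) =
      res (inf_le_right : V i ⊓ V j ≤ V j) (s j)) :
    ∃ t : Γ(X, ⊤), ∀ i, res le_top t = s i := by
  obtain ⟨t, ht, -⟩ := X.sheaf.existsUnique_gluing' V ⊤ (fun i ↦ homOfLE le_top) hV.ge s
    (fun i j ↦ h i j)
  exact ⟨t, ht⟩

/-- Local lifts of a global section along `f` that agree on overlaps glue to a global lift. -/
lemma exists_appTop_eq (f : W ⟶ Y) {ι : Type u} {V : ι → Y.Opens} (hV : ⨆ i, V i = ⊤)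
    (a : Γ(W, ⊤)) (s : ∀ i, Γ(Y, V i)) (hs : ∀ i, f.app (V i) (s i) = res le_top a)
    (h : ∀ i j, res (inf_le_left : V i ⊓ V j ≤ V i) (s i) =
      res (inf_le_right : V i ⊓ V j ≤ V j) (s j)) :
    ∃ t : Γ(Y, ⊤), f.appTop t = a := by
  obtain ⟨t, ht⟩ := exists_res_eq hV s h
  refine ⟨t, eq_of_res_eq (V := fun i ↦ f ⁻¹ᵁ V i) (fun _ ↦ le_top) ?_ fun i ↦ ?_⟩
  · rw [← Hom.preimage_iSup, hV]; rfl
  · rw [← hs, ← ht, app_res]; rfl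

lemma preimage_injective_of_surjective (f : W ⟶ Y) (hf : Function.Surjective f) {U V : Y.Opens}
    (h : f ⁻¹ᵁ U = f ⁻¹ᵁ V) : U = V := by
  ext1
  exact hf.preimage_injective congr(($h : Set W))

lemma isUnit_of_basicOpen_eq_top {s : Γ(X, ⊤)} (h : X.basicOpen s = ⊤) : IsUnit s := by
  refine X.toRingedSpace.isUnit_of_isUnit_germ ⊤ s fun x hx ↦ ?_
  exact (X.mem_basicOpen' s ⟨x, hx⟩).mp (by rw [h]; exact hx)

/-- A criterion for affineness in terms of the global functions on a scheme `W` mapping onto `Y`. -/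
lemma isAffine_of_appTop_eq_one (f : W ⟶ Y) (hf : Function.Surjective f) (S : Set Γ(Y, ⊤))
    (hS : ∀ s ∈ S, ∃ U : Y.Opens, IsAffineOpen U ∧ Y.basicOpen s ≤ U)
    {r : Γ(Y, ⊤)} (hr : r ∈ Ideal.span S) (h : f.appTop r = 1) : IsAffine Y := by
  refine isAffine_of_isAffineOpen_basicOpen S ?_ fun s hs ↦ ?_
  · refine Ideal.eq_top_of_isUnit_mem _ hr (isUnit_of_basicOpen_eq_top ?_)
    apply preimage_injective_of_surjective f hf
    rw [preimage_basicOpen_top, h, basicOpen_of_isUnit _ isUnit_one]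
    rfl
  · obtain ⟨U, hU, hsU⟩ := hS s hs
    rw [← inf_eq_right.mpr hsU, ← basicOpen_res_hom le_top]
    exact hU.basicOpen _

/-- A section over an open of the target, up to a power of `g`, extends from `D(g)`, vanishing
on the source. -/
lemma exists_res_eq_pow_mul (f : W ⟶ Y) [IsAffineHom f] {V V' : Y.Opens} (hV : IsAffineOpen V)
    (g : Γ(Y, V)) (hV' : V' = Y.basicOpen g) (h : V' ≤ V) (n : Γ(Y, V')) (hn : f.app V' n = 0) :
    ∃ (N : ℕ) (m : Γ(Y, V)), f.app V m = 0 ∧ res h m = res h g ^ N * n := by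
  subst hV'
  obtain ⟨N, m, hm⟩ := exists_eq_pow_mul_of_isAffineOpen Y V hV g n
  replace hm : res h m = res h g ^ N * n := hm
  obtain ⟨M, hM⟩ := exists_pow_mul_eq_zero_of_res_basicOpen_eq_zero_of_isAffineOpen W
    (hV.preimage f) (f.app V m) (f.app V g) (by
      have : res (f.preimage_mono h) (f.app V m) = 0 := by
        rw [← app_res f h, hm, map_mul, hn, mul_zero]
      have h2 : W.basicOpen (f.app V g) ≤ f ⁻¹ᵁ Y.basicOpen g := (preimage_basicOpen f g).ge
      have h3 := congr(res h2 $this)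
      rw [map_zero, res_res] at h3
      exact h3)
  refine ⟨M + N, g ^ M * m, by rw [map_mul, map_pow, hM], ?_⟩
  rw [map_mul, map_pow, hm, pow_add, mul_assoc]

/-- A surjective morphism from an affine scheme gives finitely many affine opens of the target
which pull back to a cover by basic opens. -/
lemma exists_affine_cover (f : W ⟶ Y) [IsClosedImmersion f] (hf : Function.Surjective f)
    [IsAffine W] :
    ∃ (t : Finset Γ(W, ⊤)) (V : t → Y.Opens), Ideal.span (t : Set Γ(W, ⊤)) = ⊤ ∧
      (∀ i, IsAffineOpen (V i)) ∧ (∀ i j, IsAffineOpen (V i ⊓ V j)) ∧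
      ⨆ i, V i = ⊤ ∧ ∀ i, f ⁻¹ᵁ V i = W.basicOpen i.1 := by
  let S : Set Γ(W, ⊤) := {s | ∃ V : Y.Opens, IsAffineOpen V ∧ f ⁻¹ᵁ V = W.basicOpen s}
  have hS : Ideal.span S = ⊤ := by
    rw [← IsAffineOpen.self_le_iSup_basicOpen_iff (isAffineOpen_top W)]
    intro x _
    obtain ⟨_, ⟨U, hU : IsAffineOpen U, rfl⟩, hxU, -⟩ :=
      Y.isBasis_affineOpens.exists_subset_of_mem_open (Set.mem_univ (f x)) isOpen_univ
    obtain ⟨s, hs, hxs⟩ := (isAffineOpen_top W).exists_basicOpen_le (V := f ⁻¹ᵁ U) ⟨x, hxU⟩ trivial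
    obtain ⟨g, hg⟩ := f.app_surjective U hU (res le_top s)
    refine Opens.mem_iSup.mpr ⟨⟨s, Y.basicOpen g, hU.basicOpen g, ?_⟩, hxs⟩
    rw [preimage_basicOpen, hg, basicOpen_res_hom, inf_eq_right.mpr hs]
  obtain ⟨t, ht, h⟩ := (Ideal.span_eq_top_iff_finite _).mp hS
  choose V hV hfV using fun i : t ↦ ht i.2
  refine ⟨t, V, h, hV, fun i j ↦ ?_, ?_, hfV⟩
  · obtain ⟨g, hg⟩ := f.app_surjective (V i) (hV i) (res le_top j.1)
    have : V i ⊓ V j = Y.basicOpen g := by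
      apply preimage_injective_of_surjective f hf
      rw [preimage_basicOpen, hg, basicOpen_res_hom, Hom.preimage_inf, hfV j]
    rw [this]
    exact (hV i).basicOpen g
  · apply preimage_injective_of_surjective f hf
    rw [Hom.preimage_iSup]
    simp only [hfV]
    exact (IsAffineOpen.iSup_basicOpen_eq_self_iff (isAffineOpen_top W)).mpr h

lemma app_congr {f g : W ⟶ Y} (h : f = g) (U : Y.Opens) (s : Γ(Y, U)) :
    f.app U s = res (by rw [h]) (g.app U s) := by
  subst h
  exact congr($(W.presheaf.map_id _) (f.app U s)).symm

/-- Global functions lift along a square-zero thickening of an affine scheme. -/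
lemma appTop_surjective_of_mul_eq_zero (f : W ⟶ Y) [IsClosedImmersion f]
    (hf : Function.Surjective f) [IsAffine W]
    (hsq : ∀ U : Y.Opens, IsAffineOpen U → ∀ x y : Γ(Y, U), f.app U x = 0 → f.app U y = 0 →
      x * y = 0) :
    Function.Surjective f.appTop := by
  intro a
  obtain ⟨t, V, ht, hV, hVV, hVtop, hfV⟩ := exists_affine_cover f hf
  choose F hF using fun i ↦ f.app_surjective (V i) (hV i) (res le_top a)
  let n (i j : t) : Γ(Y, V i ⊓ V j) := res inf_le_left (F i) - res inf_le_right (F j)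
  have hn (i j : t) : f.app _ (n i j) = 0 := by
    simp only [n, map_sub, app_res, hF, res_res, sub_self]
  let 𝔞 : Ideal Γ(W, ⊤) :=
    { carrier := {b | ∃ α m : ∀ i, Γ(Y, V i), (∀ i, f.app (V i) (α i) = res le_top b) ∧
        (∀ i, f.app (V i) (m i) = 0) ∧ ∀ i j, res inf_le_left (m i) - res inf_le_right (m j) =
          res inf_le_left (α i) * n i j}
      zero_mem' := ⟨0, 0, by simp, by simp, by simp⟩
      add_mem' := by
        rintro b b' ⟨α, m, h₁, h₂, h₃⟩ ⟨α', m', h₁', h₂', h₃'⟩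
        refine ⟨α + α', m + m', by simp [h₁, h₁'], by simp [h₂, h₂'], fun i j ↦ ?_⟩
        simp only [Pi.add_apply, map_add]
        linear_combination h₃ i j + h₃' i j
      smul_mem' := by
        rintro b c ⟨α, m, h₁, h₂, h₃⟩
        choose β hβ using fun i ↦ f.app_surjective (V i) (hV i) (res le_top b)
        refine ⟨β * α, β * m, by simp [h₁, hβ], by simp [h₂], fun i j ↦ ?_⟩
        have := hsq _ (hVV i j) (res inf_le_left (β i) - res inf_le_right (β j))
          (res inf_le_right (m j)) (by simp [app_res, hβ]) (by simp [app_res, h₂])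
        simp only [Pi.mul_apply, map_mul]
        linear_combination res inf_le_left (β i) * h₃ i j + this }
  have hpow (k : t) : k.1 ∈ 𝔞.radical := by
    choose S hS using fun i ↦ f.app_surjective (V i) (hV i) (res le_top k.1)
    have hVk (i : t) : V i ⊓ V k = Y.basicOpen (S i) := by
      apply preimage_injective_of_surjective f hf
      rw [preimage_basicOpen, hS, basicOpen_res_hom, Hom.preimage_inf, hfV k]
    choose N m hm hmN using fun i ↦
      exists_res_eq_pow_mul f (hV i) (S i) (hVk i) inf_le_left (n i k) (hn i k)
    obtain ⟨N₀, hN₀⟩ := Finite.exists_le N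
    let m' (i : t) : Γ(Y, V i) := S i ^ (N₀ - N i) * m i
    have hm' (i : t) : f.app _ (m' i) = 0 := by simp [m', hm]
    have hm'N (i : t) : res (inf_le_left : V i ⊓ V k ≤ V i) (m' i) =
        res inf_le_left (S i) ^ N₀ * n i k := by
      simp only [m', map_mul, map_pow, hmN, ← mul_assoc, ← pow_add, Nat.sub_add_cancel (hN₀ i)]
    have key (i j : t) : ∃ M : ℕ, res (inf_le_left : V i ⊓ V j ≤ V i) (S i) ^ M *
        (res inf_le_left (m' i) - res inf_le_right (m' j) -
          res inf_le_left (S i) ^ N₀ * n i j) = 0 := by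
      apply exists_pow_mul_eq_zero_of_res_basicOpen_eq_zero_of_isAffineOpen Y (hVV i j)
      set D := Y.basicOpen (res (inf_le_left : V i ⊓ V j ≤ V i) (S i)) with hD
      have hDij : D ≤ V i ⊓ V j := Y.basicOpen_le _
      have hDik : D ≤ V i ⊓ V k := by
        rw [hD, basicOpen_res_hom, ← hVk]; exact inf_le_right
      have hDjk : D ≤ V j ⊓ V k := le_inf (hDij.trans inf_le_right) (hDik.trans inf_le_right)
      change res hDij _ = 0
      have h₁ := congr(res hDik $(hm'N i))
      have h₂ := congr(res hDjk $(hm'N j))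
      have h₃ := hsq D ((hVV i j).basicOpen _)
        (res (hDij.trans inf_le_left) (S i) ^ N₀ - res (hDij.trans inf_le_right) (S j) ^ N₀)
        (res hDjk (n j k)) (by simp [app_res, hS]) (by rw [app_res, hn, map_zero])
      simp only [n, map_sub, map_mul, map_pow, res_res] at h₁ h₂ h₃ ⊢
      linear_combination h₁ - h₂ + h₃
    choose M hM using key
    obtain ⟨P, hP⟩ := Finite.exists_le (fun p : t × t ↦ M p.1 p.2)
    refine ⟨N₀ + P, fun i ↦ S i ^ (N₀ + P), fun i ↦ S i ^ P * m' i, by simp [hS], by simp [hm'],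
      fun i j ↦ ?_⟩
    have h₁ := hsq _ (hVV i j) (res inf_le_left (S i) ^ P - res inf_le_right (S j) ^ P)
      (res inf_le_right (m' j)) (by simp [app_res, hS]) (by simp [app_res, hm'])
    have h₂ := congr(res (inf_le_left : V i ⊓ V j ≤ V i) (S i) ^ (P - M i j) * $(hM i j))
    rw [← mul_assoc, ← pow_add, Nat.sub_add_cancel (hP (i, j)), mul_zero] at h₂
    simp only [map_mul, map_pow]
    linear_combination h₁ + h₂
  have htop : 𝔞 = ⊤ := by
    rw [← Ideal.radical_eq_top, ← top_le_iff, ← ht, Ideal.span_le]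
    exact fun k hk ↦ hpow ⟨k, hk⟩
  obtain ⟨α, m, h₁, h₂, h₃⟩ : (1 : Γ(W, ⊤)) ∈ 𝔞 := htop ▸ Submodule.mem_top
  refine exists_appTop_eq f hVtop a (fun i ↦ F i - m i) (by simp [hF, h₂]) fun i j ↦ ?_
  have := hsq _ (hVV i j) (res inf_le_left (α i) - 1) (n i j) (by simp [app_res, h₁]) (hn i j)
  have h₃ := h₃ i j
  simp only [n, map_sub] at this h₃ ⊢
  linear_combination -h₃ - this

/-- A square-zero thickening of an affine scheme is affine. -/
lemma isAffine_of_mul_eq_zero (f : W ⟶ Y) [IsClosedImmersion f]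
    (hf : Function.Surjective f) [IsAffine W]
    (hsq : ∀ U : Y.Opens, IsAffineOpen U → ∀ x y : Γ(Y, U), f.app U x = 0 → f.app U y = 0 →
      x * y = 0) :
    IsAffine Y := by
  obtain ⟨t, V, ht, hV, -, -, hfV⟩ := exists_affine_cover f hf
  have hsurj := appTop_surjective_of_mul_eq_zero f hf hsq
  obtain ⟨r, hr, hr1⟩ : (1 : Γ(W, ⊤)) ∈ f.appTop.hom '' Ideal.span (f.appTop.hom ⁻¹' t) := by
    have := Ideal.map_span f.appTop.hom (f.appTop.hom ⁻¹' t)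
    rw [Set.image_preimage_eq _ hsurj, ht] at this
    exact (Ideal.mem_map_iff_of_surjective _ hsurj).mp (this ▸ Submodule.mem_top)
  refine isAffine_of_appTop_eq_one f hf _ (fun s hs ↦ ⟨V ⟨_, hs⟩, hV _, ?_⟩) hr hr1
  refine (preimage_injective_of_surjective f hf ?_).le
  rw [hfV, preimage_basicOpen_top]

namespace IdealSheafData

lemma mem_ideal_sSup {c : Set X.IdealSheafData} (hc : DirectedOn (· ≤ ·) c) (hne : c.Nonempty)
    {U : X.affineOpens} {x : Γ(X, U)} : x ∈ (sSup c).ideal U ↔ ∃ C ∈ c, x ∈ C.ideal U := by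
  have := hne.to_subtype
  rw [sSup_eq_iSup', ideal_iSup, iSup_apply, Submodule.mem_iSup_of_directed]
  · simp
  · exact fun C D ↦ let ⟨E, hE, h₁, h₂⟩ := hc C C.2 D D.2; ⟨⟨E, hE⟩, h₁ U, h₂ U⟩

lemma inclusion_surjective {I J : X.IdealSheafData} (h : I ≤ J) (hJ : J.support = ⊤) :
    Function.Surjective (inclusion h) := by
  intro y
  obtain ⟨z, hz⟩ : I.subschemeι y ∈ Set.range J.subschemeι := by
    rw [range_subschemeι, hJ]; trivial
  refine ⟨z, I.subschemeι.isEmbedding.injective ?_⟩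
  rw [← hz, ← Hom.comp_apply, inclusion_subschemeι]

lemma subschemeι_surjective {J : X.IdealSheafData} (hJ : J.support = ⊤) :
    Function.Surjective J.subschemeι := by
  rw [← Set.range_eq_univ, range_subschemeι, hJ]; rfl

/-- Global functions on the subscheme of a directed supremum of ideal sheaves lift to the
subschemes far enough in the system. -/
lemma exists_inclusion_appTop_eq {c : Set X.IdealSheafData} (hc : DirectedOn (· ≤ ·) c)
    (hne : c.Nonempty) (hs : (sSup c).support = ⊤) [IsAffine (sSup c).subscheme]
    (a : Γ((sSup c).subscheme, ⊤)) :
    ∃ C : c, ∀ D : c, C ≤ D → ∃ b, (inclusion (le_sSup D.2)).appTop b = a := by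
  obtain ⟨t, V, -, hV, hVV, hVtop, -⟩ :=
    exists_affine_cover _ (subschemeι_surjective hs)
  choose F hF using fun i ↦ (sSup c).subschemeι.app_surjective (V i) (hV i) (res le_top a)
  let n (i j : t) : Γ(X, V i ⊓ V j) := res inf_le_left (F i) - res inf_le_right (F j)
  have hn (i j : t) : ∃ C : c, n i j ∈ C.1.ideal ⟨_, hVV i j⟩ := by
    obtain ⟨C, hC, h⟩ := (mem_ideal_sSup (U := ⟨_, hVV i j⟩) (x := n i j) hc hne).mp (by
      rw [← ker_subschemeι_app, RingHom.mem_ker]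
      change (sSup c).subschemeι.app (V i ⊓ V j) (n i j) = 0
      simp only [n, map_sub, app_res, hF, res_res, sub_self])
    exact ⟨⟨C, hC⟩, h⟩
  choose C hC using hn
  have : IsDirectedOrder c := ⟨fun C D ↦ let ⟨E, hE, h⟩ := hc C C.2 D D.2; ⟨⟨E, hE⟩, h⟩⟩
  have := hne.to_subtype
  obtain ⟨C₀, hC₀⟩ := Finite.exists_le (fun p : t × t ↦ C p.1 p.2)
  refine ⟨C₀, fun D hD ↦ exists_appTop_eq (V := fun i ↦ D.1.subschemeι ⁻¹ᵁ V i) _ ?_ _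
    (fun i ↦ D.1.subschemeι.app (V i) (F i)) (fun i ↦ ?_) fun i j ↦ ?_⟩
  · rw [← Hom.preimage_iSup, hVtop]; rfl
  · have := app_congr (inclusion_subschemeι (le_sSup D.2)) (V i) (F i)
    rw [hF, res_res] at this
    exact this
  · have h₁ : n i j ∈ D.1.ideal ⟨_, hVV i j⟩ := ((hC₀ (i, j)).trans hD) _ (hC i j)
    rw [← ker_subschemeι_app, RingHom.mem_ker] at h₁
    change D.1.subschemeι.app (V i ⊓ V j) (n i j) = 0 at h₁
    simp only [n, map_sub, app_res] at h₁
    exact sub_eq_zero.mp h₁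

/-- If a directed system of thickenings has an affine limit, one of its terms is affine. -/
lemma exists_isAffine_subscheme {c : Set X.IdealSheafData} (hc : DirectedOn (· ≤ ·) c)
    (hne : c.Nonempty) (hs : (sSup c).support = ⊤) [IsAffine (sSup c).subscheme] :
    ∃ C ∈ c, IsAffine C.subscheme := by
  obtain ⟨t, V, ht, hV, -, -, hfV⟩ := exists_affine_cover _ (subschemeι_surjective hs)
  obtain ⟨a, ha⟩ := Submodule.mem_span_finset'.mp
    (ht ▸ Submodule.mem_top : (1 : Γ((sSup c).subscheme, ⊤)) ∈ Ideal.span (t : Set _))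
  choose C hC using fun i ↦ exists_inclusion_appTop_eq hc hne hs (a i)
  choose C' hC' using fun i : t ↦ exists_inclusion_appTop_eq hc hne hs i.1
  have : IsDirectedOrder c := ⟨fun C D ↦ let ⟨E, hE, h⟩ := hc C C.2 D D.2; ⟨⟨E, hE⟩, h⟩⟩
  have := hne.to_subtype
  obtain ⟨D, hD⟩ := Finite.exists_le (Sum.elim C C')
  choose A hA using fun i ↦ hC i D (hD (.inl i))
  choose S hS using fun i ↦ hC' i D (hD (.inr i))
  have hsurj := inclusion_surjective (le_sSup D.2) hs
  refine ⟨D, D.2, isAffine_of_appTop_eq_one (inclusion (le_sSup D.2)) hsurj (Set.range S) ?_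
    (r := ∑ i, A i * S i) (Ideal.sum_mem _ fun i _ ↦ Ideal.mul_mem_left _ _
      (Ideal.subset_span ⟨i, rfl⟩)) ?_⟩
  · rintro _ ⟨i, rfl⟩
    refine ⟨D.1.subschemeι ⁻¹ᵁ V i, (hV i).preimage _, ?_⟩
    refine (preimage_injective_of_surjective _ hsurj ?_).le
    rw [preimage_basicOpen_top, hS, ← Hom.comp_preimage, inclusion_subschemeι, hfV]
  · simp only [map_sum, map_mul, hA, hS]
    exact ha

/-- Every ideal of sections over an affine open extends to an ideal sheaf. -/
lemma exists_ideal_eq [QuasiSeparatedSpace X] (U : X.affineOpens) (𝔞 : Ideal Γ(X, U)) :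
    ∃ L : X.IdealSheafData, L.ideal U = 𝔞 := by
  have hU : IsAffine U.1 := U.2
  have htop : U.1.ι ⁻¹ᵁ U.1 = ⊤ := by simp
  have hU' : IsAffineOpen (U.1.ι ⁻¹ᵁ U.1) := htop ▸ isAffineOpen_top _
  have hiso : IsIso (U.1.ι.app U.1) := U.1.ι.isIso_app _ (by simp)
  have hbij : Function.Bijective (U.1.ι.app U.1).hom :=
    ConcreteCategory.bijective_of_isIso (U.1.ι.app U.1)
  have hsurj : Function.Surjective (res (le_top : U.1.ι ⁻¹ᵁ U.1 ≤ ⊤)) := fun s ↦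
    ⟨res htop.ge s, by
      rw [res_res]
      exact congr($((U.1 : Scheme).presheaf.map_id _) s)⟩
  have : CompactSpace U.1 := isCompact_iff_compactSpace.mp U.2.isCompact
  refine ⟨(ofIdealTop ((𝔞.map (U.1.ι.app U.1).hom).comap (res le_top))).map U.1.ι, ?_⟩
  rw [ideal_map _ _ _ hU']
  change Ideal.comap _ (Ideal.map (res le_top) (Ideal.comap (res le_top) _)) = _
  rw [Ideal.map_comap_of_surjective _ hsurj, Ideal.comap_map_of_bijective _ hbij]

/-- Between two ideal sheaves differing by nilpotents there is one whose square lies in the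
smaller one. -/
lemma exists_mul_self_le [CompactSpace X] [QuasiSeparatedSpace X] {I J : X.IdealSheafData}
    (hIJ : I < J) (hJ : J ≤ X.nilradical) : ∃ K, I < K ∧ K ≤ J ∧ K * K ≤ I := by
  classical
  have hcov : ⨆ i : X.affineCover.finiteSubcover.I₀, (⟨_, isAffineOpen_opensRange
      (X.affineCover.finiteSubcover.f i)⟩ : X.affineOpens).1 = ⊤ :=
    X.affineCover.finiteSubcover.iSup_opensRange
  set U : X.affineCover.finiteSubcover.I₀ → X.affineOpens := fun i ↦ ⟨_, isAffineOpen_opensRange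
      (X.affineCover.finiteSubcover.f i)⟩
  induction hn : (Finset.univ.filter fun i ↦ ¬ J.ideal (U i) ≤ I.ideal (U i)).card
    using Nat.strong_induction_on generalizing J with | _ n ih
  subst hn
  obtain ⟨j, hj⟩ : ∃ j, ¬ J.ideal (U j) ≤ I.ideal (U j) := by
    by_contra! h
    exact hIJ.not_ge (le_of_iSup_eq_top U hcov h)
  obtain ⟨x, hxJ, hxI⟩ := SetLike.not_le_iff_exists.mp hj
  obtain ⟨y, hyJ, hyI, hy⟩ : ∃ y ∈ J.ideal (U j), y ∉ I.ideal (U j) ∧ y * y ∈ I.ideal (U j) := by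
    obtain ⟨m, hm⟩ : ∃ m, x ^ m ∈ (⊥ : Ideal _) := hJ (U j) hxJ
    have hex : ∃ m, x ^ (m + 1) ∈ I.ideal (U j) :=
      ⟨m, by rw [pow_succ, (Ideal.mem_bot.mp hm), zero_mul]; exact zero_mem _⟩
    obtain ⟨k, hk⟩ : ∃ k, Nat.find hex = k + 1 := Nat.exists_eq_succ_of_ne_zero fun h ↦ by
      have := Nat.find_spec hex
      rw [h] at this
      exact hxI (by simpa using this)
    have h₁ := Nat.find_spec hex
    rw [hk] at h₁
    refine ⟨x ^ (k + 1), Ideal.pow_mem_of_mem _ hxJ _ k.succ_pos,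
      Nat.find_min hex (hk ▸ k.lt_succ_self), ?_⟩
    rw [← pow_add, show k + 1 + (k + 1) = k + 1 + 1 + k by ring, pow_add]
    exact Ideal.mul_mem_right _ _ h₁
  obtain ⟨L, hL⟩ := exists_ideal_eq (U j) (Ideal.span {y})
  let K := I ⊔ J ⊓ L
  have hKJ : K ≤ J := sup_le hIJ.le inf_le_left
  have hKU : K.ideal (U j) ≤ I.ideal (U j) ⊔ Ideal.span {y} := by
    change I.ideal (U j) ⊔ J.ideal (U j) ⊓ L.ideal (U j) ≤ _
    rw [hL]
    exact sup_le_sup_left inf_le_right _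
  have hyK : y ∈ K.ideal (U j) := by
    change y ∈ I.ideal (U j) ⊔ J.ideal (U j) ⊓ L.ideal (U j)
    exact Ideal.mem_sup_right ⟨hyJ, hL ▸ Ideal.mem_span_singleton_self y⟩
  have hIK : I < K := lt_of_le_not_ge le_sup_left fun h ↦ hyI (h (U j) hyK)
  by_cases hKK : K * K ≤ I
  · exact ⟨K, hIK, hKJ, hKK⟩
  have hsq : (K * K).ideal (U j) ≤ I.ideal (U j) := by
    refine (Ideal.mul_mono hKU hKU).trans ?_
    rw [Ideal.sup_mul, Ideal.mul_sup (Ideal.span {y}), Ideal.span_singleton_mul_span_singleton]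
    refine sup_le Ideal.mul_le_left (sup_le Ideal.mul_le_right ?_)
    rwa [Ideal.span_singleton_le_iff_mem]
  have hKKJ : I ⊔ K * K ≤ J := sup_le hIJ.le fun V ↦ Ideal.mul_le_right.trans (hKJ V)
  have hlt : I < I ⊔ K * K := lt_of_le_not_ge le_sup_left fun h ↦ hKK (le_sup_right.trans h)
  have hcard : (Finset.univ.filter fun i ↦ ¬ (I ⊔ K * K).ideal (U i) ≤ I.ideal (U i)) ⊂
      Finset.univ.filter fun i ↦ ¬ J.ideal (U i) ≤ I.ideal (U i) := by
    rw [Finset.ssubset_iff_of_subset]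
    · exact ⟨j, by simpa using hj, by simpa using hsq⟩
    · intro i hi
      simp only [Finset.mem_filter, Finset.mem_univ, true_and] at hi ⊢
      exact fun h ↦ hi ((hKKJ (U i)).trans h)
  obtain ⟨K', h₁, h₂, h₃⟩ := ih _ (Finset.card_lt_card hcard) hlt (hKKJ.trans hJ) rfl
  exact ⟨K', h₁, h₂.trans hKKJ, h₃⟩

/-- Affineness of a subscheme passes to a square-zero thickening inside the ambient scheme. -/
lemma isAffine_subscheme_of_mul_self_le {I J : X.IdealSheafData} (h : I ≤ J)
    (hJ : J.support = ⊤) (hsq : J * J ≤ I) [IsAffine J.subscheme] : IsAffine I.subscheme := by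
  have key : (inclusion h).ker * (inclusion h).ker ≤ ⊥ := by
    refine le_of_iSup_eq_top (fun V : X.affineOpens ↦ ⟨_, V.2.preimage I.subschemeι⟩) ?_
      fun V ↦ ?_
    · rw [← Hom.preimage_iSup, iSup_affineOpens_eq_top]; rfl
    · rw [ideal_mul, Pi.mul_apply, Hom.ker_apply, Ideal.mul_le]
      have hmem (a : Γ(X, V)) (ha : (inclusion h).app (I.subschemeι ⁻¹ᵁ V)
          (I.subschemeι.app V a) = 0) : a ∈ J.ideal V := by
        rw [← ker_subschemeι_app, RingHom.mem_ker]
        have := app_congr (inclusion_subschemeι h).symm V a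
        exact this.trans ((congrArg _ ha).trans (map_zero _))
      intro x hx y hy
      obtain ⟨a, rfl⟩ := I.subschemeι.app_surjective V V.2 x
      obtain ⟨b, rfl⟩ := I.subschemeι.app_surjective V V.2 y
      have hab : a * b ∈ RingHom.ker (I.subschemeι.app V).hom :=
        (I.ker_subschemeι_app V).symm ▸ hsq V (Ideal.mul_mem_mul (hmem a hx) (hmem b hy))
      rw [← map_mul]
      exact hab
  refine isAffine_of_mul_eq_zero (inclusion h) (inclusion_surjective h hJ) fun U hU x y hx hy ↦ ?_
  refine key ⟨U, hU⟩ (Ideal.mul_mem_mul ?_ ?_) <;> rwa [Hom.ker_apply]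

/-- A nil thickening of an affine scheme is affine. -/
lemma isAffine_of_support_eq_top (I : X.IdealSheafData) (hI : I.support = ⊤)
    [IsAffine I.subscheme] : IsAffine X := by
  have hsupp {J : X.IdealSheafData} (h : J ≤ I) : J.support = ⊤ :=
    top_le_iff.mp (hI ▸ support_antitone h)
  let e : I.subscheme ≃ₜ X := I.subschemeι.isEmbedding.toHomeomorphOfSurjective
    (subschemeι_surjective hI)
  have : CompactSpace X := e.compactSpace
  have : QuasiSeparatedSpace X := (quasiSeparatedSpace_congr e).mp inferInstance
  have hbot : IsAffine (⊥ : X.IdealSheafData).subscheme := by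
    by_contra hbot
    obtain ⟨J, -, ⟨hJI, hJ⟩, hmax⟩ := zorn_le_nonempty₀
      {J : X.IdealSheafData | J ≤ I ∧ ¬ IsAffine J.subscheme} (fun c hc hchain C hC ↦ by
        have hle : sSup c ≤ I := sSup_le fun D hD ↦ (hc hD).1
        refine ⟨sSup c, ⟨hle, fun h ↦ ?_⟩, fun D hD ↦ le_sSup hD⟩
        obtain ⟨D, hD, hD'⟩ := exists_isAffine_subscheme hchain.directedOn ⟨C, hC⟩ (hsupp hle)
        exact (hc hD).2 hD') ⊥ ⟨bot_le, hbot⟩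
    have hlt : J < I := lt_of_le_of_ne hJI (by rintro rfl; exact hJ ‹_›)
    obtain ⟨K, hJK, hKI, hKK⟩ := exists_mul_self_le hlt (by
      rw [← vanishingIdeal_top, ← le_support_iff_le_vanishingIdeal, hI])
    have : IsAffine K.subscheme := by
      by_contra hK
      exact hJK.not_ge (hmax ⟨hKI, hK⟩ hJK.le)
    exact hJ (isAffine_subscheme_of_mul_self_le hJK.le (hsupp hKI) hKK)
  exact .of_isIso (inv (⊥ : X.IdealSheafData).subschemeι)

end IdealSheafData

/-- The target of a surjective closed immersion from an affine scheme is affine. -/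
lemma isAffine_of_surjective_of_isClosedImmersion (f : W ⟶ Y) [IsClosedImmersion f]
    (hf : Function.Surjective f) [IsAffine W] : IsAffine Y := by
  have : IsAffine f.ker.subscheme := .of_isIso (inv f.toImage)
  refine f.ker.isAffine_of_support_eq_top ?_
  ext1
  rw [Hom.support_ker, hf.range_eq, closure_univ]
  rfl

/-- If a closed subscheme is affine, so is every closed subscheme with the same support. -/
lemma isAffine_of_range_eq (f : W ⟶ X) (g : Y ⟶ X) [IsClosedImmersion f] [IsClosedImmersion g]
    (h : Set.range f = Set.range g) [IsAffine W] : IsAffine Y := by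
  have : IsAffine (Limits.pullback f g) := isAffine_of_isAffineHom (Limits.pullback.fst f g)
  refine isAffine_of_surjective_of_isClosedImmersion (Limits.pullback.snd f g) ?_
  rw [← Set.range_eq_univ, Pullback.range_snd, h]
  exact Set.preimage_range _

end AlgebraicGeometry.Scheme

/-- Let `X` be a scheme and `W, W′ ⊆ X` closed subschemes with the same
underlying topological space.  Then `W` is affine if and only if `W′` is affine. -/
theorem affine_iff_of_same_support
    (X W W' : AlgebraicGeometry.Scheme)
    (f : W ⟶ X) (g : W' ⟶ X)
    [IsClosedImmersion f] [IsClosedImmersion g]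
    (h : Set.range f.base = Set.range g.base) :
    IsAffine W ↔ IsAffine W' := by
  exact ⟨fun _ ↦ Scheme.isAffine_of_range_eq f g h,
    fun _ ↦ Scheme.isAffine_of_range_eq g f h.symm⟩
end

section
/- Let A be a commutative ring and f ∈ A((t))^× a unit of the Laurent series ring over A, with A local (so that ν(f) is well-defined). Then f admits a unique factorization f = (∏_{i=−∞}^{−1}(1 − a_i t^i)) · a₀ t^{ν(f)} · ∏_{i=1}^{∞}(1 − a_i t^i), where a₀ ∈ A^×, a_i ∈ A for i > 0, and a_i nilpotent for i < 0 with a_i = 0 for all but finitely many i < 0. -/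
open HahnSeries

noncomputable section

variable {A : Type*} [CommRing A]

/-- The `N`-th partial product associated to the data `(ν, a)`:
`(∏_{i<0} (1 − a_i t^i)) · a₀ t^ν · ∏_{i=1}^{N} (1 − a_i t^i)`.
The product over `i < 0` is a finite product (`finprod`), since all but
finitely many of the `a_i` with `i < 0` vanish. -/
def ccPartialProd (ν : ℤ) (a : ℤ → A) (N : ℕ) : LaurentSeries A :=
  (∏ᶠ i : {j : ℤ // j < 0}, (1 - (HahnSeries.single (i : ℤ) (a i) : LaurentSeries A))) *
    HahnSeries.single (0 : ℤ) (a 0) * HahnSeries.single ν (1 : A) *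
    ∏ i ∈ Finset.range N, (1 - (HahnSeries.single ((i : ℤ) + 1) (a (i + 1)) : LaurentSeries A))

end

noncomputable section

namespace LaurentSeries

variable {A : Type*} [CommRing A]

section CoeffIdeal

/-- The ideal of Laurent series all of whose coefficients lie in `J`. -/
def coeffIdeal (J : Ideal A) : Ideal (LaurentSeries A) where
  carrier := {x | ∀ n, x.coeff n ∈ J}
  add_mem' hx hy n := by
    rw [HahnSeries.coeff_add]
    exact J.add_mem (hx n) (hy n)
  zero_mem' n := by simp
  smul_mem' c x hx n := by
    rw [smul_eq_mul, HahnSeries.coeff_mul]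
    exact J.sum_mem fun ij _ => J.mul_mem_left _ (hx ij.2)

theorem mem_coeffIdeal {J : Ideal A} {x : LaurentSeries A} :
    x ∈ coeffIdeal J ↔ ∀ n, x.coeff n ∈ J := Iff.rfl

theorem single_mem_coeffIdeal {J : Ideal A} {r : A} (hr : r ∈ J) (n : ℤ) :
    (HahnSeries.single n r : LaurentSeries A) ∈ coeffIdeal J := by
  intro m
  rw [HahnSeries.coeff_single]
  split_ifs
  exacts [hr, J.zero_mem]

theorem coeffIdeal_mul_le (I J : Ideal A) :
    coeffIdeal I * coeffIdeal J ≤ coeffIdeal (I * J) := by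
  refine Ideal.mul_le.2 fun x hx y hy n => ?_
  rw [HahnSeries.coeff_mul]
  exact Ideal.sum_mem _ fun ij _ => Ideal.mul_mem_mul (hx _) (hy _)

theorem coeffIdeal_mono {I J : Ideal A} (h : I ≤ J) : coeffIdeal I ≤ coeffIdeal J :=
  fun _ hx n => h (hx n)

theorem eq_zero_of_mem_coeffIdeal_bot {x : LaurentSeries A}
    (hx : x ∈ coeffIdeal (⊥ : Ideal A)) : x = 0 := by
  ext n
  simpa using hx n

theorem mul_mem_coeffIdeal_pow_succ {I : Ideal A} {k : ℕ} {x y : LaurentSeries A}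
    (hx : x ∈ coeffIdeal I) (hy : y ∈ coeffIdeal (I ^ k)) :
    x * y ∈ coeffIdeal (I ^ (k + 1)) := by
  rw [pow_succ']
  exact coeffIdeal_mul_le _ _ (Ideal.mul_mem_mul hx hy)

end CoeffIdeal

section Products

/-- Modulo `I`, a finite product of factors `1 - x i` with `x i ∈ I` is `1`. -/
theorem _root_.Ideal.prod_one_sub_sub_one_mem {R ι : Type*} [CommRing R] {I : Ideal R}
    (s : Finset ι) {x : ι → R} (hx : ∀ i ∈ s, x i ∈ I) :
    ∏ i ∈ s, (1 - x i) - 1 ∈ I := by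
  classical
  induction s using Finset.induction_on with
  | empty => simp
  | insert i s hi ih =>
    rw [Finset.prod_insert hi]
    have h1 := ih fun j hj => hx j (Finset.mem_insert_of_mem hj)
    have h2 := I.mul_mem_right (∏ j ∈ s, (1 - x j)) (hx i (Finset.mem_insert_self i s))
    convert I.sub_mem h1 h2 using 1
    ring

/-- First-order expansion of a perturbed product of factors `1 - x i`. -/
theorem _root_.Ideal.prod_one_sub_add_mem {R ι : Type*} [CommRing R] {I J : Ideal R}
    (hJI : J ≤ I) (s : Finset ι) {x y : ι → R} (hx : ∀ i ∈ s, x i ∈ I)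
    (hy : ∀ i ∈ s, y i ∈ J) :
    ∏ i ∈ s, (1 - (x i + y i)) - ∏ i ∈ s, (1 - x i) + ∑ i ∈ s, y i ∈ I * J := by
  classical
  induction s using Finset.induction_on with
  | empty => simp
  | insert i s hi ih =>
    rw [Finset.prod_insert hi, Finset.prod_insert hi, Finset.sum_insert hi]
    have hxs : ∀ j ∈ s, x j ∈ I := fun j hj => hx j (Finset.mem_insert_of_mem hj)
    have hys : ∀ j ∈ s, y j ∈ J := fun j hj => hy j (Finset.mem_insert_of_mem hj)
    have hxi := hx i (Finset.mem_insert_self i s)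
    have hyi := hy i (Finset.mem_insert_self i s)
    have h0 := ih hxs hys
    have h1 := Ideal.mul_mem_mul (I.add_mem hxi (hJI hyi)) (J.sum_mem hys)
    have h2 := Ideal.mul_mem_mul (Ideal.prod_one_sub_sub_one_mem s hxs) hyi
    have h3 := (I * J).mul_mem_left (1 - (x i + y i)) h0
    convert (I * J).add_mem ((I * J).sub_mem h3 h2) h1 using 1
    ring

/-- The product of the factors `1 - a i t^i` over `-M ≤ i < 0`. -/
def negProd (M : ℕ) (a : ℤ → A) : LaurentSeries A :=
  ∏ i ∈ Finset.Ico (-(M : ℤ)) 0, (1 - HahnSeries.single i (a i))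

theorem negProd_sub_one_mem {I : Ideal A} (M : ℕ) {a : ℤ → A} (ha : ∀ i < 0, a i ∈ I) :
    negProd M a - 1 ∈ coeffIdeal I :=
  Ideal.prod_one_sub_sub_one_mem _ fun i hi =>
    single_mem_coeffIdeal (ha i (Finset.mem_Ico.1 hi).2) i

theorem negProd_add_mem {I : Ideal A} {k : ℕ} (M : ℕ) {a δ : ℤ → A}
    (ha : ∀ i < 0, a i ∈ I) (hδ : ∀ i < 0, δ i ∈ I ^ (k + 1)) :
    negProd M (a + δ) - negProd M a + ∑ i ∈ Finset.Ico (-(M : ℤ)) 0, HahnSeries.single i (δ i) ∈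
      coeffIdeal (I ^ (k + 2)) := by
  have h := Ideal.prod_one_sub_add_mem (coeffIdeal_mono (Ideal.pow_le_self k.succ_ne_zero))
    (Finset.Ico (-(M : ℤ)) 0) (x := fun i => (HahnSeries.single i (a i) : LaurentSeries A))
    (y := fun i => HahnSeries.single i (δ i))
    (fun i hi => single_mem_coeffIdeal (ha i (Finset.mem_Ico.1 hi).2) i)
    (fun i hi => single_mem_coeffIdeal (hδ i (Finset.mem_Ico.1 hi).2) i)
  rw [pow_succ' I (k + 1)]
  simpa only [negProd, Pi.add_apply, HahnSeries.single_add] using coeffIdeal_mul_le _ _ h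

theorem negProd_eq_of_le {M N : ℕ} (h : M ≤ N) {a : ℤ → A}
    (ha : ∀ i < -(M : ℤ), a i = 0) : negProd N a = negProd M a := by
  symm
  refine Finset.prod_subset (Finset.Ico_subset_Ico_left (by lia)) fun i hi hi' => ?_
  rw [Finset.mem_Ico] at hi hi'
  simp [ha i (by lia)]

theorem finprod_eq_negProd {M : ℕ} {a : ℤ → A} (ha : ∀ i < -(M : ℤ), a i = 0) :
    ∏ᶠ i : {j : ℤ // j < 0}, (1 - (HahnSeries.single (i : ℤ) (a i) : LaurentSeries A)) =
      negProd M a := by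
  rw [finprod_subtype_eq_finprod_cond (f := fun i =>
    (1 - (HahnSeries.single i (a i) : LaurentSeries A))) fun j : ℤ => j < 0]
  refine finprod_cond_eq_prod_of_cond_iff _ fun {i} hi => ?_
  rw [Finset.mem_Ico]
  refine ⟨fun h => ⟨?_, h⟩, fun h => h.2⟩
  by_contra! hlt
  exact hi (by simp [ha i hlt])

theorem exists_nat_forall_lt_eq_zero {a : ℤ → A} (ha : {i : ℤ | i < 0 ∧ a i ≠ 0}.Finite) :
    ∃ M : ℕ, ∀ i < -(M : ℤ), a i = 0 := by
  obtain ⟨b, hb⟩ := ha.bddBelow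
  refine ⟨b.natAbs, fun i hi => ?_⟩
  by_contra hne
  have := hb (show i ∈ {i : ℤ | i < 0 ∧ a i ≠ 0} from ⟨by lia, hne⟩)
  lia

theorem exists_nat_forall_coeff_eq_zero (x : LaurentSeries A) :
    ∃ M : ℕ, ∀ i < -(M : ℤ), x.coeff i = 0 :=
  ⟨x.order.natAbs, fun i hi => HahnSeries.coeff_eq_zero_of_lt_order (by lia)⟩

theorem coeff_mul_eq_zero_of_lt {x y : LaurentSeries A} {p q : ℤ}
    (hx : ∀ i < p, x.coeff i = 0) (hy : ∀ i < q, y.coeff i = 0) {d : ℤ} (hd : d < p + q) :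
    (x * y).coeff d = 0 := by
  rw [HahnSeries.coeff_mul]
  refine Finset.sum_eq_zero fun ij hij => ?_
  rw [Finset.mem_antidiagonal] at hij
  rcases lt_or_ge ij.1 p with h | h
  · rw [hx _ h, zero_mul]
  · rw [hy _ (by lia), mul_zero]

theorem coeff_sum_single {M : ℕ} {a : ℤ → A} (ha : ∀ i < -(M : ℤ), a i = 0) (n : ℤ) :
    (∑ i ∈ Finset.Ico (-(M : ℤ)) 0, HahnSeries.single i (a i) : LaurentSeries A).coeff n =
      if n < 0 then a n else 0 := by
  rw [HahnSeries.coeff_sum]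
  by_cases hn : n ∈ Finset.Ico (-(M : ℤ)) 0
  · rw [Finset.sum_eq_single_of_mem n hn fun i _ hi => HahnSeries.coeff_single_of_ne hi.symm,
      HahnSeries.coeff_single_same, if_pos (Finset.mem_Ico.1 hn).2]
  · rw [Finset.sum_eq_zero fun i hi => HahnSeries.coeff_single_of_ne
      (by rintro rfl; exact hn hi)]
    split_ifs with h
    · rw [ha n (by rw [Finset.mem_Ico] at hn; lia)]
    · rfl

end Products

section PosProd

open PowerSeries

/-- The product of the factors `1 - c i X^(i+1)` over `i < N`. -/
def posPartialProd (c : ℕ → A) (N : ℕ) : PowerSeries A :=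
  ∏ i ∈ Finset.range N, (1 - monomial (i + 1) (c i))

/-- The `X`-adic limit of the products `posPartialProd c N`. -/
def posProd (c : ℕ → A) : PowerSeries A :=
  PowerSeries.mk fun n => coeff n (posPartialProd c n)

theorem posPartialProd_succ (c : ℕ → A) (N : ℕ) :
    posPartialProd c (N + 1) = posPartialProd c N * (1 - monomial (N + 1) (c N)) :=
  Finset.prod_range_succ _ _

theorem coeff_posPartialProd_succ_of_le (c : ℕ → A) {n N : ℕ} (h : n ≤ N) :
    coeff n (posPartialProd c (N + 1)) = coeff n (posPartialProd c N) := by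
  rw [posPartialProd_succ, mul_sub, mul_one, map_sub, sub_eq_self, monomial_eq_C_mul_X_pow,
    mul_left_comm, coeff_C_mul, coeff_mul_X_pow', if_neg (by lia), mul_zero]

theorem coeff_posPartialProd_of_le (c : ℕ → A) {n N : ℕ} (h : n ≤ N) :
    coeff n (posPartialProd c N) = coeff n (posProd c) := by
  induction N, h using Nat.le_induction with
  | base => simp [posProd]
  | succ N h ih => rw [coeff_posPartialProd_succ_of_le c h, ih]

theorem coeff_zero_posPartialProd (c : ℕ → A) (N : ℕ) : coeff 0 (posPartialProd c N) = 1 := by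
  rw [coeff_posPartialProd_of_le c N.zero_le, posProd, coeff_mk]
  simp [posPartialProd]

theorem coeff_zero_posProd (c : ℕ → A) : coeff 0 (posProd c) = 1 := by
  rw [← coeff_posPartialProd_of_le c le_rfl, coeff_zero_posPartialProd]

theorem coeff_succ_posPartialProd_succ (c : ℕ → A) (N : ℕ) :
    coeff (N + 1) (posPartialProd c (N + 1)) = coeff (N + 1) (posPartialProd c N) - c N := by
  rw [posPartialProd_succ, mul_sub, mul_one, map_sub, monomial_eq_C_mul_X_pow,
    mul_left_comm, coeff_C_mul, coeff_mul_X_pow', if_pos le_rfl, Nat.sub_self,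
    coeff_zero_posPartialProd, mul_one]

theorem posProd_injective : Function.Injective (posProd (A := A)) := by
  intro c c' h
  funext n
  induction n using Nat.strong_induction_on with
  | _ n ih =>
    have hQ : posPartialProd c n = posPartialProd c' n :=
      Finset.prod_congr rfl fun i hi => by rw [ih i (Finset.mem_range.1 hi)]
    have h1 := coeff_succ_posPartialProd_succ c n
    have h2 := coeff_succ_posPartialProd_succ c' n
    rw [coeff_posPartialProd_of_le _ le_rfl] at h1 h2
    rw [h, h2, hQ] at h1
    exact (sub_right_injective h1).symm

/-- The partial products of the factorization of `u`, the next factor being chosen to correct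
the first wrong coefficient. -/
def approxProd (u : PowerSeries A) : ℕ → PowerSeries A
  | 0 => 1
  | N + 1 => approxProd u N *
      (1 - monomial (N + 1) (coeff (N + 1) (approxProd u N) - coeff (N + 1) u))

theorem exists_posProd_eq {u : PowerSeries A} (hu : coeff 0 u = 1) : ∃ c, posProd c = u := by
  let c : ℕ → A := fun N => coeff (N + 1) (approxProd u N) - coeff (N + 1) u
  have hQ (N : ℕ) : posPartialProd c N = approxProd u N := by
    induction N with
    | zero => simp [posPartialProd, approxProd]
    | succ N ih => rw [posPartialProd_succ, ih, approxProd]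
  refine ⟨c, PowerSeries.ext fun n => ?_⟩
  cases n with
  | zero => rw [coeff_zero_posProd, hu]
  | succ n =>
    rw [← coeff_posPartialProd_of_le c le_rfl, coeff_succ_posPartialProd_succ, hQ]
    exact sub_sub_cancel _ _

end PosProd

section Factorization

theorem coe_monomial (n : ℕ) (r : A) :
    ((PowerSeries.monomial n r : PowerSeries A) : LaurentSeries A) =
      HahnSeries.single (n : ℤ) r := by
  rw [PowerSeries.monomial_eq_C_mul_X_pow, PowerSeries.coe_mul, PowerSeries.coe_C,
    HahnSeries.ofPowerSeries_X_pow, HahnSeries.C_apply, HahnSeries.single_mul_single]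
  simp

theorem ccPartialProd_eq {M : ℕ} {a : ℤ → A} (ha : ∀ i < -(M : ℤ), a i = 0) (ν : ℤ) (N : ℕ) :
    ccPartialProd ν a N = negProd M a * HahnSeries.single 0 (a 0) * HahnSeries.single ν 1 *
      (posPartialProd (fun n => a (n + 1)) N : LaurentSeries A) := by
  rw [ccPartialProd, finprod_eq_negProd ha, posPartialProd, map_prod]
  congr 1
  refine Finset.prod_congr rfl fun i _ => ?_
  rw [PowerSeries.coe_sub, PowerSeries.coe_one, coe_monomial]
  simp

theorem eventually_coeff_ccPartialProd {M : ℕ} {a : ℤ → A} (ha : ∀ i < -(M : ℤ), a i = 0)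
    (ν d : ℤ) : ∃ N₀ : ℕ, ∀ N ≥ N₀, (ccPartialProd ν a N).coeff d =
      (negProd M a * HahnSeries.single 0 (a 0) * HahnSeries.single ν 1 *
        (posProd (fun n => a (n + 1)) : LaurentSeries A)).coeff d := by
  set x : LaurentSeries A := negProd M a * HahnSeries.single 0 (a 0) * HahnSeries.single ν 1
    with hx
  obtain ⟨K, hK⟩ := exists_nat_forall_coeff_eq_zero x
  refine ⟨(d + K).toNat, fun N hN => ?_⟩
  rw [ccPartialProd_eq ha, ← hx, ← sub_eq_zero, ← HahnSeries.coeff_sub, ← mul_sub,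
    ← PowerSeries.coe_sub]
  refine coeff_mul_eq_zero_of_lt hK (q := N + 1) (fun i hi => ?_) (by lia)
  rw [PowerSeries.coeff_coe]
  split_ifs with h
  · rfl
  · rw [map_sub, coeff_posPartialProd_of_le _ (by lia), sub_self]

theorem forall_eventually_coeff_ccPartialProd_iff {M : ℕ} {a : ℤ → A}
    (ha : ∀ i < -(M : ℤ), a i = 0) (ν : ℤ) (f : LaurentSeries A) :
    (∀ d : ℤ, ∃ N₀ : ℕ, ∀ N ≥ N₀, (ccPartialProd ν a N).coeff d = f.coeff d) ↔
      f = negProd M a * HahnSeries.single ν 1 *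
        ((PowerSeries.C (a 0) * posProd fun n => a (n + 1) : PowerSeries A) :
          LaurentSeries A) := by
  have hrw : negProd M a * HahnSeries.single 0 (a 0) * HahnSeries.single ν 1 *
      (posProd (fun n => a (n + 1)) : LaurentSeries A) = negProd M a * HahnSeries.single ν 1 *
        ((PowerSeries.C (a 0) * posProd fun n => a (n + 1) : PowerSeries A) :
          LaurentSeries A) := by
    rw [PowerSeries.coe_mul, PowerSeries.coe_C, HahnSeries.C_apply]
    ring
  rw [← hrw]
  constructor
  · intro h
    ext d
    obtain ⟨N₁, h₁⟩ := h d
    obtain ⟨N₂, h₂⟩ := eventually_coeff_ccPartialProd ha ν d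
    rw [← h₁ _ (le_max_left N₁ N₂), h₂ _ (le_max_right N₁ N₂)]
  · rintro rfl d
    exact eventually_coeff_ccPartialProd ha ν d

theorem exists_isUnit_coeff [IsLocalRing A] {f : LaurentSeries A} (hf : IsUnit f) :
    ∃ ν : ℤ, IsUnit (f.coeff ν) ∧ ∀ i < ν, IsNilpotent (f.coeff i) := by
  obtain ⟨g, hfg⟩ := hf.exists_right_inv
  -- the least index of a coefficient outside a prime ideal
  have key (p : Ideal A) [p.IsPrime] (x y : LaurentSeries A) (hxy : x * y = 1) :
      ∃ n, x.coeff n ∉ p ∧ ∀ i < n, x.coeff i ∈ p := by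
    obtain ⟨M, hM⟩ := exists_nat_forall_coeff_eq_zero x
    have hex : ∃ n, x.coeff n ∉ p := by
      by_contra! h
      have h1 : (1 : LaurentSeries A) ∈ coeffIdeal p :=
        hxy ▸ (coeffIdeal p).mul_mem_right y (mem_coeffIdeal.2 h)
      exact (Ideal.ne_top_iff_one p).1 Ideal.IsPrime.ne_top' (by simpa using h1 0)
    obtain ⟨n, hn, hmin⟩ := Int.exists_least_of_bdd (P := fun n => x.coeff n ∉ p)
      ⟨-M, fun z hz => by
        by_contra! h
        exact hz (hM z h ▸ p.zero_mem)⟩ hex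
    exact ⟨n, hn, fun i hi => by_contra fun h => (hmin i h).not_gt hi⟩
  have hunit (p : Ideal A) [p.IsPrime] : ∃ n, IsUnit (f.coeff n) ∧ ∀ i < n, f.coeff i ∈ p := by
    obtain ⟨n, hn, hlt⟩ := key p f g hfg
    obtain ⟨m, hm, hgt⟩ := key p g f (by rw [mul_comm, hfg])
    have hsub : (f * g).coeff (n + m) - f.coeff n * g.coeff m ∈ p := by
      classical
      rw [← Ideal.Quotient.eq, HahnSeries.coeff_mul, map_sum]
      rw [Finset.sum_eq_single (n, m)]
      · rintro ⟨i, j⟩ hij hne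
        rw [Finset.mem_antidiagonal] at hij
        have hij' : i + j = n + m := hij.2.2
        rw [Ideal.Quotient.eq_zero_iff_mem]
        rcases lt_trichotomy i n with h | rfl | h
        · exact p.mul_mem_right _ (hlt i h)
        · exact absurd (by rw [add_left_cancel hij']) hne
        · exact p.mul_mem_left _ (hgt j (by lia))
      · intro hnot
        rw [Ideal.Quotient.eq_zero_iff_mem]
        by_contra h
        refine hnot ?_
        rw [Finset.mem_antidiagonal]
        exact ⟨fun h0 => hn (h0 ▸ p.zero_mem), fun h0 => hm (h0 ▸ p.zero_mem), rfl⟩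
    have hnot : f.coeff n * g.coeff m ∉ p := fun h =>
      (Ideal.IsPrime.mem_or_mem ‹_› h).elim hn hm
    rw [hfg, HahnSeries.coeff_one] at hsub
    split_ifs at hsub with h0
    · refine ⟨n, ?_, hlt⟩
      have hmem : 1 - f.coeff n * g.coeff m ∈ IsLocalRing.maximalIdeal A :=
        IsLocalRing.le_maximalIdeal Ideal.IsPrime.ne_top' hsub
      have : IsUnit (f.coeff n * g.coeff m) := by
        by_contra h
        refine (Ideal.ne_top_iff_one _).1 (IsLocalRing.maximalIdeal.isMaximal A).ne_top ?_
        simpa using Ideal.add_mem _ hmem ((IsLocalRing.mem_maximalIdeal _).2 h)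
      exact isUnit_of_mul_isUnit_left this
    · rw [zero_sub, neg_mem_iff] at hsub
      exact absurd hsub hnot
  obtain ⟨ν, hν, hlt⟩ := hunit (IsLocalRing.maximalIdeal A)
  refine ⟨ν, hν, fun i hi => nilpotent_iff_mem_prime.2 fun p hp => ?_⟩
  obtain ⟨n, hn, hlt'⟩ := hunit p
  refine hlt' i (hi.trans_le ?_)
  by_contra! h
  exact (IsLocalRing.mem_maximalIdeal _).1 (hlt n h) hn

theorem exists_negProd_mul_sub_mem {I : Ideal A} (hI : I ≤ nilradical A) {g : LaurentSeries A}
    (hneg : ∀ i < 0, g.coeff i ∈ I) (h0 : IsUnit (g.coeff 0)) (k : ℕ) :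
    ∃ (M : ℕ) (a : ℤ → A) (u : PowerSeries A), (∀ i < 0, a i ∈ I) ∧
      (∀ i < -(M : ℤ), a i = 0) ∧ IsUnit u ∧
      g - negProd M a * (u : LaurentSeries A) ∈ coeffIdeal (I ^ (k + 1)) := by
  induction k with
  | zero =>
    refine ⟨0, 0, PowerSeries.mk fun n => g.coeff n, by simp, by simp, ?_, fun n => ?_⟩
    · rw [PowerSeries.isUnit_iff_constantCoeff]
      simpa using h0
    · rw [HahnSeries.coeff_sub, show negProd 0 (0 : ℤ → A) = 1 by simp [negProd], one_mul,
        PowerSeries.coeff_coe, zero_add, pow_one]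
      split_ifs with h
      · simpa using hneg n h
      · simp [Int.natAbs_of_nonneg (not_lt.1 h)]
  | succ k ih =>
    obtain ⟨M, a, u, haI, haM, hu, hr⟩ := ih
    obtain ⟨v, huv⟩ := hu.exists_right_inv
    have huv' : (u : LaurentSeries A) * (v : LaurentSeries A) = 1 := by
      rw [← PowerSeries.coe_mul, huv, PowerSeries.coe_one]
    set s : LaurentSeries A := (g - negProd M a * u) * v with hs
    have hsI : s ∈ coeffIdeal (I ^ (k + 1)) := Ideal.mul_mem_right _ _ hr
    obtain ⟨K, hK⟩ := exists_nat_forall_coeff_eq_zero s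
    set δ : ℤ → A := fun i => if i < 0 then -s.coeff i else 0 with hδ
    set ε : PowerSeries A := PowerSeries.mk fun n => s.coeff n with hε
    have hδI : ∀ i < 0, δ i ∈ I ^ (k + 1) := fun i hi => by
      simpa [hδ, hi] using hsI i
    have hδK : ∀ i < -(K : ℤ), δ i = 0 := fun i hi => by simp [hδ, hK i hi]
    have hεI : (ε : LaurentSeries A) ∈ coeffIdeal (I ^ (k + 1)) := fun n => by
      rw [PowerSeries.coeff_coe]
      split_ifs with h
      · exact Ideal.zero_mem _
      · simpa [hε] using hsI _
    set L := max M K with hL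
    have hsplit : s = (ε : LaurentSeries A) -
        ∑ i ∈ Finset.Ico (-(L : ℤ)) 0, HahnSeries.single i (δ i) := by
      ext n
      rw [HahnSeries.coeff_sub, coeff_sum_single (fun i hi => hδK i (by lia)),
        PowerSeries.coeff_coe]
      split_ifs with hn
      · simp [hδ, hn]
      · simp [hε, Int.natAbs_of_nonneg (not_lt.1 hn)]
    have hle : I ^ (k + 1) ≤ I := Ideal.pow_le_self k.succ_ne_zero
    have haδ : ∀ i < 0, (a + δ) i ∈ I := fun i hi => I.add_mem (haI i hi) (hle (hδI i hi))
    refine ⟨L, a + δ, u * (1 + ε), haδ, fun i hi => ?_, hu.mul ?_, ?_⟩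
    · rw [Pi.add_apply, haM i (by lia), hδK i (by lia), add_zero]
    · rw [PowerSeries.isUnit_iff_constantCoeff]
      have h : IsNilpotent (s.coeff 0) := mem_nilradical.1 (hI (hle (hsI 0)))
      simpa [hε] using h.isUnit_one_add
    · have h1 := negProd_add_mem L haI hδI
      have h2 := mul_mem_coeffIdeal_pow_succ (negProd_sub_one_mem L haδ) hεI
      rw [negProd_eq_of_le (le_max_left M K) haM] at h1
      have h3 : s * u = g - negProd M a * u := by
        rw [hs, mul_assoc, mul_comm (v : LaurentSeries A), huv', mul_one]
      rw [PowerSeries.coe_mul, PowerSeries.coe_add, PowerSeries.coe_one]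
      have h4 := Ideal.mul_mem_right (u : LaurentSeries A) _ (add_mem h1 h2)
      rw [← neg_mem_iff] at h4
      convert h4 using 1
      rw [hsplit] at h3
      linear_combination -h3

theorem exists_eq_negProd_mul {g : LaurentSeries A}
    (hneg : ∀ i < 0, IsNilpotent (g.coeff i)) (h0 : IsUnit (g.coeff 0)) :
    ∃ (M : ℕ) (a : ℤ → A) (u : PowerSeries A), (∀ i < 0, IsNilpotent (a i)) ∧
      (∀ i < -(M : ℤ), a i = 0) ∧ IsUnit u ∧ g = negProd M a * (u : LaurentSeries A) := by
  classical
  obtain ⟨K, hK⟩ := exists_nat_forall_coeff_eq_zero g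
  set I : Ideal A := Ideal.span ((Finset.Ico (-(K : ℤ)) 0).image g.coeff) with hIdef
  have hI : I ≤ nilradical A := by
    rw [hIdef, Ideal.span_le]
    intro x hx
    obtain ⟨i, hi, rfl⟩ := Finset.mem_image.1 (Finset.mem_coe.1 hx)
    exact hneg i (Finset.mem_Ico.1 hi).2
  obtain ⟨n, hn⟩ := (Ideal.FG.isNilpotent_iff_le_nilradical ⟨_, rfl⟩).2 hI
  have hgI : ∀ i < 0, g.coeff i ∈ I := fun i hi => by
    rcases lt_or_ge i (-(K : ℤ)) with h | h
    · exact hK i h ▸ I.zero_mem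
    · exact Ideal.subset_span
        (Finset.mem_coe.2 (Finset.mem_image_of_mem _ (Finset.mem_Ico.2 ⟨h, hi⟩)))
  obtain ⟨M, a, u, haI, haM, hu, hr⟩ := exists_negProd_mul_sub_mem hI hgI h0 n
  refine ⟨M, a, u, fun i hi => hI (haI i hi), haM, hu, ?_⟩
  have hbot : I ^ (n + 1) = ⊥ := by rw [pow_succ, hn, zero_mul, Ideal.zero_eq_bot]
  rw [hbot] at hr
  exact sub_eq_zero.1 (eq_zero_of_mem_coeffIdeal_bot hr)

theorem negProd_mul_coe_sub_mem {I : Ideal A} {M : ℕ} {a a' : ℤ → A} {u u' : PowerSeries A}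
    (ha : ∀ i < 0, a i ∈ I) (ha' : ∀ i < 0, a' i ∈ I) (haM : ∀ i < -(M : ℤ), a i = 0)
    (haM' : ∀ i < -(M : ℤ), a' i = 0) (hu' : IsUnit u')
    (h : negProd M a * (u : LaurentSeries A) = negProd M a' * (u' : LaurentSeries A)) (k : ℕ) :
    (∀ i < 0, (a' - a) i ∈ I ^ (k + 1)) ∧
      (u' : LaurentSeries A) - u ∈ coeffIdeal (I ^ (k + 1)) := by
  induction k with
  | zero =>
    rw [zero_add, pow_one]
    refine ⟨fun i hi => I.sub_mem (ha' i hi) (ha i hi), ?_⟩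
    have h1 := Ideal.mul_mem_right (u : LaurentSeries A) _ (negProd_sub_one_mem M ha)
    have h2 := Ideal.mul_mem_right (u' : LaurentSeries A) _ (negProd_sub_one_mem M ha')
    convert sub_mem h1 h2 using 1
    linear_combination -h
  | succ k ih =>
    obtain ⟨hδ, hsub⟩ := ih
    obtain ⟨v, huv⟩ := hu'.exists_right_inv
    have huv' : (u' : LaurentSeries A) * (v : LaurentSeries A) = 1 := by
      rw [← PowerSeries.coe_mul, huv, PowerSeries.coe_one]
    set D : LaurentSeries A :=
      ∑ i ∈ Finset.Ico (-(M : ℤ)) 0, HahnSeries.single i ((a' - a) i) with hD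
    have hDcoeff (n : ℤ) : D.coeff n = if n < 0 then (a' - a) n else 0 :=
      coeff_sum_single (fun i hi => by rw [Pi.sub_apply, haM i hi, haM' i hi, sub_zero]) n
    have h1 := negProd_add_mem M ha hδ
    rw [add_sub_cancel, ← hD] at h1
    have h2 := mul_mem_coeffIdeal_pow_succ (negProd_sub_one_mem M ha) hsub
    have h3 : D * u' - (u' - u) ∈ coeffIdeal (I ^ (k + 2)) := by
      convert add_mem (Ideal.mul_mem_right (u' : LaurentSeries A) _ h1) h2 using 1
      linear_combination h
    have h4 : D - (((u' - u) * v : PowerSeries A) : LaurentSeries A) ∈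
        coeffIdeal (I ^ (k + 2)) := by
      convert Ideal.mul_mem_right (v : LaurentSeries A) _ h3 using 1
      rw [PowerSeries.coe_mul, PowerSeries.coe_sub]
      linear_combination -D * huv'
    have hδ' : ∀ i < 0, (a' - a) i ∈ I ^ (k + 2) := fun i hi => by
      have := h4 i
      rwa [HahnSeries.coeff_sub, hDcoeff, if_pos hi, PowerSeries.coeff_coe, if_pos hi,
        sub_zero] at this
    refine ⟨hδ', ?_⟩
    have hDI : D ∈ coeffIdeal (I ^ (k + 2)) := fun n => by
      rw [hDcoeff]
      split_ifs with hn
      exacts [hδ' n hn, Ideal.zero_mem _]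
    simpa using sub_mem (Ideal.mul_mem_right (u' : LaurentSeries A) _ hDI) h3

theorem negProd_mul_coe_injective {M : ℕ} {a a' : ℤ → A} {u u' : PowerSeries A}
    (ha : ∀ i < 0, IsNilpotent (a i)) (ha' : ∀ i < 0, IsNilpotent (a' i))
    (haM : ∀ i < -(M : ℤ), a i = 0) (haM' : ∀ i < -(M : ℤ), a' i = 0) (hu' : IsUnit u')
    (h : negProd M a * (u : LaurentSeries A) = negProd M a' * (u' : LaurentSeries A)) :
    (∀ i < 0, a i = a' i) ∧ u = u' := by
  classical
  set S := Finset.Ico (-(M : ℤ)) 0 with hS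
  set I : Ideal A := Ideal.span (S.image a ∪ S.image a' : Finset A) with hIdef
  have hI : I ≤ nilradical A := by
    rw [hIdef, Ideal.span_le]
    intro x hx
    rcases Finset.mem_union.1 (Finset.mem_coe.1 hx) with hx | hx
    · obtain ⟨i, hi, rfl⟩ := Finset.mem_image.1 hx
      exact ha i (Finset.mem_Ico.1 hi).2
    · obtain ⟨i, hi, rfl⟩ := Finset.mem_image.1 hx
      exact ha' i (Finset.mem_Ico.1 hi).2
  obtain ⟨n, hn⟩ := (Ideal.FG.isNilpotent_iff_le_nilradical ⟨_, rfl⟩).2 hI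
  have haI : ∀ i < 0, a i ∈ I := fun i hi => by
    rcases lt_or_ge i (-(M : ℤ)) with h | h
    · exact haM i h ▸ I.zero_mem
    · exact Ideal.subset_span (Finset.mem_coe.2 (Finset.mem_union_left _
        (Finset.mem_image_of_mem _ (Finset.mem_Ico.2 ⟨h, hi⟩))))
  have haI' : ∀ i < 0, a' i ∈ I := fun i hi => by
    rcases lt_or_ge i (-(M : ℤ)) with h | h
    · exact haM' i h ▸ I.zero_mem
    · exact Ideal.subset_span (Finset.mem_coe.2 (Finset.mem_union_right _
        (Finset.mem_image_of_mem _ (Finset.mem_Ico.2 ⟨h, hi⟩))))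
  have hbot : I ^ (n + 1) = ⊥ := by rw [pow_succ, hn, zero_mul, Ideal.zero_eq_bot]
  obtain ⟨h1, h2⟩ := negProd_mul_coe_sub_mem haI haI' haM haM' hu' h n
  rw [hbot] at h1 h2
  refine ⟨fun i hi => (sub_eq_zero.1 (Ideal.mem_bot.1 (h1 i hi))).symm, ?_⟩
  exact (HahnSeries.ofPowerSeries_injective
    (sub_eq_zero.1 (eq_zero_of_mem_coeffIdeal_bot h2))).symm

theorem coeff_negProd_mul_single_mul {M : ℕ} {a : ℤ → A} (ha : ∀ i < 0, IsNilpotent (a i))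
    {u : PowerSeries A} (hu : IsUnit u) (ν : ℤ) :
    IsUnit ((negProd M a * HahnSeries.single ν 1 * (u : LaurentSeries A)).coeff ν) ∧
      ∀ i < ν, IsNilpotent
        ((negProd M a * HahnSeries.single ν 1 * (u : LaurentSeries A)).coeff i) := by
  have hmem : negProd M a * HahnSeries.single ν 1 * (u : LaurentSeries A) -
      HahnSeries.single ν 1 * (u : LaurentSeries A) ∈ coeffIdeal (nilradical A) := by
    convert Ideal.mul_mem_right (HahnSeries.single ν 1 * (u : LaurentSeries A)) _
      (negProd_sub_one_mem (I := nilradical A) M ha) using 1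
    ring
  have hcoeff (i : ℤ) : IsNilpotent
      ((negProd M a * HahnSeries.single ν 1 * (u : LaurentSeries A)).coeff i -
        (u : LaurentSeries A).coeff (i - ν)) := by
    have := hmem i
    rwa [HahnSeries.coeff_sub, HahnSeries.coeff_single_mul, one_mul] at this
  refine ⟨?_, fun i hi => ?_⟩
  · have h1 : IsUnit ((u : LaurentSeries A).coeff (ν - ν)) := by
      rw [sub_self, PowerSeries.coeff_coe]
      simpa using PowerSeries.isUnit_iff_constantCoeff.1 hu
    simpa using (hcoeff ν).isUnit_add_left_of_commute h1 (Commute.all _ _)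
  · have := hcoeff i
    rwa [PowerSeries.coeff_coe, if_pos (by lia), sub_zero] at this

end Factorization

end LaurentSeries

end

open LaurentSeries

/-- Over a commutative local ring `A`, every unit `f` of `A((t))`
admits a unique factorization
`f = (∏_{i=−∞}^{−1} (1 − a_i t^i)) · a₀ t^{ν(f)} · ∏_{i=1}^{∞} (1 − a_i t^i)`,
with `a₀ ∈ A^×`, the `a_i` for `i < 0` nilpotent and almost all zero, and
`a_i ∈ A` arbitrary for `i > 0`.  The infinite product over `i > 0` converges
`t`-adically, expressed here by stabilization of each coefficient of the
partial products. -/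
theorem laurentSeries_unit_factorization
    (A : Type*) [CommRing A] [IsLocalRing A] (f : (LaurentSeries A)ˣ) :
    ∃! p : ℤ × (ℤ → A),
      IsUnit (p.2 0) ∧
      (∀ i : ℤ, i < 0 → IsNilpotent (p.2 i)) ∧
      {i : ℤ | i < 0 ∧ p.2 i ≠ 0}.Finite ∧
      (∀ d : ℤ, ∃ N₀ : ℕ, ∀ N ≥ N₀,
        (ccPartialProd p.1 p.2 N).coeff d = (f : LaurentSeries A).coeff d) := by
  obtain ⟨ν, hν, hnil⟩ := exists_isUnit_coeff f.isUnit
  have hss : (HahnSeries.single ν 1 * HahnSeries.single (-ν) 1 : LaurentSeries A) = 1 := by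
    rw [HahnSeries.single_mul_single, add_neg_cancel, one_mul, HahnSeries.single_zero_one]
  obtain ⟨M, b, u, hb, hbM, hu, hfac⟩ :=
    exists_eq_negProd_mul (g := HahnSeries.single (-ν) 1 * (f : LaurentSeries A))
      (fun i hi => by
        rw [HahnSeries.coeff_single_mul, one_mul]
        exact hnil _ (by lia))
      (by simpa [HahnSeries.coeff_single_mul] using hν)
  have hf : (f : LaurentSeries A) =
      negProd M b * HahnSeries.single ν 1 * (u : LaurentSeries A) := by
    linear_combination (HahnSeries.single ν 1 : LaurentSeries A) * hfac -
      (f : LaurentSeries A) * hss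
  obtain ⟨c₀, hc₀⟩ := PowerSeries.isUnit_iff_constantCoeff.1 hu
  obtain ⟨c, hc⟩ := exists_posProd_eq (u := PowerSeries.C (↑c₀⁻¹ : A) * u) (by
    rw [PowerSeries.coeff_C_mul, PowerSeries.coeff_zero_eq_constantCoeff_apply, ← hc₀,
      Units.inv_mul])
  have hcu : PowerSeries.C (c₀ : A) * posProd c = u := by
    rw [hc, ← mul_assoc, ← map_mul, Units.mul_inv, map_one, one_mul]
  let a : ℤ → A := fun i => if i < 0 then b i else if i = 0 then c₀ else c (i - 1).toNat
  have ha0 : a 0 = c₀ := by simp [a]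
  have haneg : ∀ i < 0, a i = b i := fun i hi => by simp [a, hi]
  have hapos : (fun n : ℕ => a (n + 1)) = c := by
    funext n
    have h1 : ¬ (n : ℤ) + 1 < 0 := by lia
    have h2 : (n : ℤ) + 1 ≠ 0 := by lia
    simp [a, h1, h2]
  have haM : ∀ i < -(M : ℤ), a i = 0 := fun i hi => by rw [haneg i (by lia), hbM i hi]
  have hP : negProd M a = negProd M b :=
    Finset.prod_congr rfl fun i hi => by rw [haneg i (Finset.mem_Ico.1 hi).2]
  refine ⟨(ν, a), ⟨(congrArg IsUnit ha0).mpr c₀.isUnit, fun i hi => ?_, ?_, ?_⟩, ?_⟩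
  · exact (congrArg IsNilpotent (haneg i hi)).mpr (hb i hi)
  · refine (Set.finite_Ico (-(M : ℤ)) 0).subset fun i hi => ⟨?_, hi.1⟩
    by_contra! h
    exact hi.2 (haM i h)
  · rw [forall_eventually_coeff_ccPartialProd_iff haM]
    simp only [hapos, ha0, hcu, hP, hf]
  · rintro ⟨ν', a'⟩ ⟨ha0', hnil', hfin', hconv'⟩
    dsimp only at ha0' hnil' hfin' hconv'
    obtain ⟨M', haM'⟩ := exists_nat_forall_lt_eq_zero hfin'
    rw [forall_eventually_coeff_ccPartialProd_iff haM'] at hconv'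
    set u' := PowerSeries.C (a' 0) * posProd fun n => a' (n + 1) with hudef'
    have hcu0' : PowerSeries.constantCoeff u' = a' 0 := by
      rw [hudef', map_mul, PowerSeries.constantCoeff_C,
        ← PowerSeries.coeff_zero_eq_constantCoeff_apply, coeff_zero_posProd, mul_one]
    have hu' : IsUnit u' := PowerSeries.isUnit_iff_constantCoeff.2 (hcu0' ▸ ha0')
    obtain ⟨hν', hlt'⟩ := coeff_negProd_mul_single_mul (M := M') hnil' hu' ν'
    rw [← hconv'] at hν' hlt'
    have hνν : ν' = ν := by
      rcases lt_trichotomy ν' ν with h | h | h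
      · exact absurd hν' (hnil _ h).not_isUnit
      · exact h
      · exact absurd hν (hlt' _ h).not_isUnit
    subst hνν
    set L := max M M'
    have hprod : negProd L a' * (u' : LaurentSeries A) = negProd L b * (u : LaurentSeries A) := by
      rw [negProd_eq_of_le (le_max_right M M') haM', negProd_eq_of_le (le_max_left M M') hbM,
        ← hfac, hconv']
      linear_combination -(negProd M' a' * (u' : LaurentSeries A)) * hss
    obtain ⟨hneg, huu⟩ := negProd_mul_coe_injective hnil' hb
      (fun i hi => haM' i (by lia)) (fun i hi => hbM i (by lia)) hu hprod
    have h0 : a' 0 = c₀ := by rw [← hcu0', huu, hc₀]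
    have hpos : (fun n : ℕ => a' (n + 1)) = c := by
      refine posProd_injective ?_
      rw [hc, ← huu, hudef', ← mul_assoc, ← map_mul, h0, Units.inv_mul, map_one, one_mul]
    refine Prod.ext rfl (funext fun i => ?_)
    change a' i = a i
    rcases lt_trichotomy i 0 with h | rfl | h
    · rw [hneg i h, haneg i h]
    · rw [h0, ha0]
    · obtain ⟨n, rfl⟩ : ∃ n : ℕ, i = n + 1 := ⟨(i - 1).toNat, by lia⟩
      exact congrFun (hpos.trans hapos.symm) n
end
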